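/- At the extremal parameter λ* (the supremum of λ > 0 for which (P_λ) has a classical radial solution), there exists an integral solution: a function u* : (0,1] → (-∞,0] satisfying u*(r) = -∫_r^1 [ c_{n,k}^{-1} τ^{k-n} ∫_0^τ s^{n-1+σ} λ* (1-u*(s))^q ds ]^{1/k} dτ for almost every r ∈ (0,1). Moreover u* is the pointwise decreasing limit of the maximal solutions u_{λ_i} of (P_{λ_i}) along any increasing sequence λ_i ↑ λ*. -/

import Mathlib

open Real Set Filter MeasureTheory

noncomputable section

/-- `c_{n,k} = (1/n) * binom(n,k)`. -/
def cnk (n k : ℕ) : ℝ := (n.choose k : ℝ) / n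

/-- The critical exponent `q*(k,σ) = ((n+2)k + σ(k+1))/(n-2k)`. -/
def qstar (n k : ℕ) (σ : ℝ) : ℝ :=
  (((n : ℝ) + 2) * k + σ * ((k : ℝ) + 1)) / ((n : ℝ) - 2 * k)

/-- The Joseph–Lundgren type exponent `q_JL(k,σ)` (finite formula, valid
for `n > 2k + 8 + 4σ/k`). -/
def qJL (n k : ℕ) (σ : ℝ) : ℝ :=
  (k : ℝ) *
    (((k : ℝ) * ((k : ℝ) + 1) * n - (k : ℝ) ^ 2 * (2 - σ) + 2 * k + σ -
        2 * Real.sqrt ((k : ℝ) * (2 * k + σ) * (((k : ℝ) + 1) * n - (k : ℝ) * (2 - σ)))) /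
      ((k : ℝ) * ((k : ℝ) + 1) * n - 2 * (k : ℝ) ^ 2 * ((k : ℝ) + 3) - 2 * k * σ -
        2 * Real.sqrt ((k : ℝ) * (2 * k + σ) * (((k : ℝ) + 1) * n - (k : ℝ) * (2 - σ)))))

/-- `λ̃(k,σ) = c_{n,k} τ_σ^k (n - 2k - k τ_σ)` with `τ_σ = (2k+σ)/(q-k)`. -/
def lamTilde (n k : ℕ) (q σ : ℝ) : ℝ :=
  cnk n k * ((2 * (k : ℝ) + σ) / (q - k)) ^ k *
    ((n : ℝ) - 2 * k - (k : ℝ) * ((2 * (k : ℝ) + σ) / (q - k)))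

/-- `μ*(k,σ) = binom(n,k) ((n+σ)/n) (n-2k)^k / (k+1)^{k+1}`. -/
def muStar (n k : ℕ) (σ : ℝ) : ℝ :=
  (n.choose k : ℝ) * (((n : ℝ) + σ) / n) * ((n : ℝ) - 2 * k) ^ k / ((k : ℝ) + 1) ^ (k + 1)

/-- A classical radial solution of problem `(P_λ)`:
`u ∈ C²((0,1)) ∩ C¹([0,1])`, `u'(0) = 0`, `u(1) = 0`, `u < 0` on `(0,1)`,
`(r^{n-i} (u')^i)' ≥ 0` on `(0,1)` for `i = 1,…,k`, and
`c_{n,k} r^{1-n} (r^{n-k}(u')^k)' = λ r^σ (1-u)^q` on `(0,1)`. -/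
def IsRadialSol (n k : ℕ) (q σ lam : ℝ) (u : ℝ → ℝ) : Prop :=
  ContDiffOn ℝ 2 u (Ioo 0 1) ∧ ContDiffOn ℝ 1 u (Icc 0 1) ∧
  deriv u 0 = 0 ∧ u 1 = 0 ∧
  (∀ r ∈ Ioo (0:ℝ) 1, u r < 0) ∧
  (∀ i : ℕ, 1 ≤ i → i ≤ k →
    ∀ r ∈ Ioo (0:ℝ) 1, 0 ≤ deriv (fun s => s ^ ((n : ℝ) - i) * (deriv u s) ^ i) r) ∧
  (∀ r ∈ Ioo (0:ℝ) 1,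
    cnk n k * r ^ (1 - (n : ℝ)) *
        deriv (fun s => s ^ ((n : ℝ) - k) * (deriv u s) ^ k) r =
      lam * r ^ σ * (1 - u r) ^ q)

/-- A radial subsolution of `(P_λ)`. -/
def IsRadialSubsol (n k : ℕ) (q σ lam : ℝ) (u : ℝ → ℝ) : Prop :=
  ContDiffOn ℝ 2 u (Ioo 0 1) ∧ ContDiffOn ℝ 1 u (Icc 0 1) ∧
  (∀ i : ℕ, 1 ≤ i → i ≤ k →
    ∀ r ∈ Ioo (0:ℝ) 1, 0 ≤ deriv (fun s => s ^ ((n : ℝ) - i) * (deriv u s) ^ i) r) ∧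
  (∀ r ∈ Ioo (0:ℝ) 1,
    lam * r ^ σ * (1 - u r) ^ q ≤
      cnk n k * r ^ (1 - (n : ℝ)) *
        deriv (fun s => s ^ ((n : ℝ) - k) * (deriv u s) ^ k) r) ∧
  u 1 ≤ 0


/-- The inner integrand. -/
def hh (a q : ℝ) (f : ℝ → ℝ) (s : ℝ) : ℝ := s ^ a * (1 - f s) ^ q

/-- The inner integral. -/
def II (a q : ℝ) (f : ℝ → ℝ) (τ : ℝ) : ℝ := ∫ s in Ioc 0 τ, hh a q f s

/-- The outer integrand. -/
def JJ (a b C κ q lam : ℝ) (f : ℝ → ℝ) (τ : ℝ) : ℝ := (C⁻¹ * τ ^ b * (lam * II a q f τ)) ^ κ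

/-- The integral operator. -/
def TT (a b C κ q lam : ℝ) (f : ℝ → ℝ) (r : ℝ) : ℝ := -∫ τ in Ioc r 1, JJ a b C κ q lam f τ

structure GoodF (a q : ℝ) (f : ℝ → ℝ) : Prop where
  mono : MonotoneOn f (Ioc 0 1)
  nonpos : ∀ r ∈ Ioc (0:ℝ) 1, f r ≤ 0
  int : IntegrableOn (hh a q f) (Ioc 0 1)

lemma hh_nonneg {a q : ℝ} {f : ℝ → ℝ} (hf : ∀ r ∈ Ioc (0:ℝ) 1, f r ≤ 0) {s : ℝ}
    (hs : s ∈ Ioc (0:ℝ) 1) : 0 ≤ hh a q f s := by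
  unfold hh
  have := hf s hs
  have h0 := hs.1
  have : 0 ≤ 1 - f s := by linarith
  positivity

lemma hh_le {a q : ℝ} (hq : 0 ≤ q) {f g : ℝ → ℝ} {s : ℝ} (hs : 0 < s) (hf : f s ≤ 0)
    (hgf : g s ≤ f s) : hh a q f s ≤ hh a q g s := by
  unfold hh
  apply mul_le_mul_of_nonneg_left _ (by positivity)
  apply Real.rpow_le_rpow <;> linarith

lemma hh_meas {a q : ℝ} {f : ℝ → ℝ} (hf : MonotoneOn f (Ioc 0 1)) :
    AEStronglyMeasurable (hh a q f) (volume.restrict (Ioc (0:ℝ) 1)) := by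
  have h1 : AEMeasurable f (volume.restrict (Ioc (0:ℝ) 1)) :=
    aemeasurable_restrict_of_monotoneOn measurableSet_Ioc hf
  have h2 : AEMeasurable (hh a q f) (volume.restrict (Ioc (0:ℝ) 1)) :=
    (aemeasurable_id.pow_const a).mul ((h1.const_sub 1).pow_const q)
  exact h2.aestronglyMeasurable

lemma II_nonneg {a q : ℝ} {f : ℝ → ℝ} (hf : ∀ r ∈ Ioc (0:ℝ) 1, f r ≤ 0) {τ : ℝ}
    (hτ : τ ≤ 1) : 0 ≤ II a q f τ :=
  setIntegral_nonneg measurableSet_Ioc fun _ hs => hh_nonneg hf ⟨hs.1, hs.2.trans hτ⟩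

lemma II_mono {a q : ℝ} {f : ℝ → ℝ} (hf : GoodF a q f) {τ t : ℝ} (h : τ ≤ t)
    (ht : t ≤ 1) : II a q f τ ≤ II a q f t := by
  apply setIntegral_mono_set (hf.int.mono_set (Ioc_subset_Ioc_right ht))
  · exact (ae_restrict_iff' measurableSet_Ioc).2
      (Eventually.of_forall fun s hs => hh_nonneg hf.nonpos ⟨hs.1, hs.2.trans ht⟩)
  · exact (Ioc_subset_Ioc_right h).eventuallyLE

lemma II_anti {a q : ℝ} (hq : 0 ≤ q) {f g : ℝ → ℝ} (hf : GoodF a q f) (hg : GoodF a q g)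
    (h : ∀ r ∈ Ioc (0:ℝ) 1, g r ≤ f r) {τ : ℝ} (hτ : τ ≤ 1) : II a q f τ ≤ II a q g τ := by
  apply setIntegral_mono_on (hf.int.mono_set (Ioc_subset_Ioc_right hτ))
    (hg.int.mono_set (Ioc_subset_Ioc_right hτ)) measurableSet_Ioc
  intro s hs
  have hs' : s ∈ Ioc (0:ℝ) 1 := ⟨hs.1, hs.2.trans hτ⟩
  exact hh_le hq hs.1 (hf.nonpos s hs') (h s hs')

lemma JJ_nonneg {a b C κ q lam : ℝ} (hC : 0 < C) (hl : 0 ≤ lam) {f : ℝ → ℝ}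
    (hf : ∀ r ∈ Ioc (0:ℝ) 1, f r ≤ 0) {τ : ℝ} (hτ : τ ∈ Ioc (0:ℝ) 1) :
    0 ≤ JJ a b C κ q lam f τ := by
  unfold JJ
  have := II_nonneg (a := a) (q := q) hf hτ.2
  have h0 := hτ.1
  positivity

lemma JJ_le {a b C κ q lam mu : ℝ} (hC : 0 < C) (hκ : 0 ≤ κ) (hq : 0 ≤ q) (hl : 0 ≤ lam)
    (hlm : lam ≤ mu) {f g : ℝ → ℝ} (hf : GoodF a q f) (hg : GoodF a q g)
    (h : ∀ r ∈ Ioc (0:ℝ) 1, g r ≤ f r) {τ : ℝ} (hτ : τ ∈ Ioc (0:ℝ) 1) :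
    JJ a b C κ q lam f τ ≤ JJ a b C κ q mu g τ := by
  unfold JJ
  have h1 := II_nonneg (a := a) (q := q) hf.nonpos hτ.2
  have h2 := II_anti hq hf hg h hτ.2
  have h0 := hτ.1
  have hmu : 0 ≤ mu := hl.trans hlm
  gcongr

lemma JJ_meas {a b C κ q lam : ℝ} {f : ℝ → ℝ} (hf : GoodF a q f) {r : ℝ} :
    AEStronglyMeasurable (JJ a b C κ q lam f) (volume.restrict (Ioc r 1)) := by
  have h1 : MonotoneOn (II a q f) (Ioc r 1) := fun x _ y hy hxy => II_mono hf hxy hy.2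
  have h2 : AEMeasurable (II a q f) (volume.restrict (Ioc r 1)) :=
    aemeasurable_restrict_of_monotoneOn measurableSet_Ioc h1
  have h3 : AEMeasurable (JJ a b C κ q lam f) (volume.restrict (Ioc r 1)) :=
    (((aemeasurable_id.pow_const b).const_mul C⁻¹).mul (h2.const_mul lam)).pow_const κ
  exact h3.aestronglyMeasurable

lemma JJ_bound {a b C κ q lam : ℝ} (hC : 0 < C) (hκ : 0 ≤ κ) (hb : b ≤ 0)
    (hl : 0 ≤ lam) {f : ℝ → ℝ} (hf : GoodF a q f) {r : ℝ} (hr : 0 < r) {τ : ℝ}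
    (hτ : τ ∈ Ioc r 1) :
    JJ a b C κ q lam f τ ≤ (C⁻¹ * r ^ b * (lam * II a q f 1)) ^ κ := by
  unfold JJ
  have h1 := II_nonneg (a := a) (q := q) hf.nonpos hτ.2
  have h2 := II_mono hf hτ.2 le_rfl
  have h3 : τ ^ b ≤ r ^ b := Real.rpow_le_rpow_of_nonpos hr hτ.1.le hb
  have h0 := hr.trans hτ.1
  gcongr

lemma JJ_int {a b C κ q lam : ℝ} (hC : 0 < C) (hκ : 0 ≤ κ) (hb : b ≤ 0)
    (hl : 0 ≤ lam) {f : ℝ → ℝ} (hf : GoodF a q f) {r : ℝ} (hr : 0 < r) :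
    IntegrableOn (JJ a b C κ q lam f) (Ioc r 1) := by
  refine Integrable.mono' (g := fun _ => (C⁻¹ * r ^ b * (lam * II a q f 1)) ^ κ) ?_ ?_ ?_
  · exact integrable_const _
  · exact JJ_meas hf
  · refine (ae_restrict_iff' measurableSet_Ioc).2 (Eventually.of_forall fun s hs => ?_)
    rw [Real.norm_of_nonneg (JJ_nonneg hC hl hf.nonpos ⟨hr.trans hs.1, hs.2⟩)]
    exact JJ_bound hC hκ hb hl hf hr hs

lemma TT_le {a b C κ q lam mu : ℝ} (hC : 0 < C) (hκ : 0 ≤ κ) (hb : b ≤ 0) (hq : 0 ≤ q)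
    (hl : 0 ≤ lam)
    (hlm : lam ≤ mu) {f g : ℝ → ℝ} (hf : GoodF a q f) (hg : GoodF a q g)
    (h : ∀ r ∈ Ioc (0:ℝ) 1, g r ≤ f r) {r : ℝ} (hr : 0 < r) :
    TT a b C κ q mu g r ≤ TT a b C κ q lam f r := by
  unfold TT
  apply neg_le_neg
  apply setIntegral_mono_on (JJ_int hC hκ hb hl hf hr)
    (JJ_int hC hκ hb (hl.trans hlm) hg hr) measurableSet_Ioc
  intro s hs
  exact JJ_le hC hκ hq hl hlm hf hg h ⟨hr.trans hs.1, hs.2⟩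

lemma TT_nonpos {a b C κ q lam : ℝ} (hC : 0 < C) (hl : 0 ≤ lam) {f : ℝ → ℝ}
    (hf : GoodF a q f) {r : ℝ} (hr : 0 < r) : TT a b C κ q lam f r ≤ 0 := by
  unfold TT
  apply neg_nonpos_of_nonneg
  exact setIntegral_nonneg measurableSet_Ioc fun s hs =>
    JJ_nonneg hC hl hf.nonpos ⟨hr.trans hs.1, hs.2⟩

lemma TT_mono {a b C κ q lam : ℝ} (hC : 0 < C) (hκ : 0 ≤ κ) (hb : b ≤ 0) (hl : 0 ≤ lam)
    {f : ℝ → ℝ} (hf : GoodF a q f) : MonotoneOn (TT a b C κ q lam f) (Ioc 0 1) := by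
  intro x hx y hy hxy
  unfold TT
  apply neg_le_neg
  apply setIntegral_mono_set (JJ_int hC hκ hb hl hf hx.1)
  · exact (ae_restrict_iff' measurableSet_Ioc).2
      (Eventually.of_forall fun s hs => JJ_nonneg hC hl hf.nonpos ⟨hx.1.trans hs.1, hs.2⟩)
  · exact (Ioc_subset_Ioc_left hxy).eventuallyLE

lemma GoodF_of_le {a q : ℝ} (hq : 0 ≤ q) {f g : ℝ → ℝ} (hg : GoodF a q g)
    (h1 : MonotoneOn f (Ioc 0 1)) (h2 : ∀ r ∈ Ioc (0:ℝ) 1, f r ≤ 0)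
    (h : ∀ r ∈ Ioc (0:ℝ) 1, g r ≤ f r) : GoodF a q f := by
  refine ⟨h1, h2, ?_⟩
  refine Integrable.mono' hg.int (hh_meas h1) ?_
  refine (ae_restrict_iff' measurableSet_Ioc).2 (Eventually.of_forall fun s hs => ?_)
  rw [Real.norm_of_nonneg (hh_nonneg h2 hs)]
  exact hh_le hq hs.1 (h2 s hs) (h s hs)

lemma limit_lemma {a b C κ q : ℝ} (hC : 0 < C) (hκ : 0 ≤ κ) (hb : b ≤ 0) (hq : 0 ≤ q)
    (F : ℕ → ℝ → ℝ) (hF : ∀ i, GoodF a q (F i))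
    (hanti : ∀ r ∈ Ioc (0:ℝ) 1, Antitone fun i => F i r) (f : ℝ → ℝ)
    (hlim : ∀ r ∈ Ioc (0:ℝ) 1, Tendsto (fun i => F i r) atTop (nhds (f r)))
    (M : ℝ) (hM : ∀ i, II a q (F i) 1 ≤ M) (lam : ℕ → ℝ) (L : ℝ) (hl : ∀ i, 0 ≤ lam i)
    (hlL : ∀ i, lam i ≤ L) (hlamlim : Tendsto lam atTop (nhds L)) :
    GoodF a q f ∧ ∀ r ∈ Ioc (0:ℝ) 1,
      Tendsto (fun i => TT a b C κ q (lam i) (F i) r) atTop (nhds (TT a b C κ q L f r)) := by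
  have hmono : MonotoneOn f (Ioc 0 1) := fun x hx y hy hxy =>
    le_of_tendsto_of_tendsto' (hlim x hx) (hlim y hy) fun i => (hF i).mono hx hy hxy
  have hnp : ∀ r ∈ Ioc (0:ℝ) 1, f r ≤ 0 := fun r hr =>
    le_of_tendsto' (hlim r hr) fun i => (hF i).nonpos r hr
  have hfle : ∀ i, ∀ r ∈ Ioc (0:ℝ) 1, f r ≤ F i r := fun i r hr =>
    (hanti r hr).le_of_tendsto (hlim r hr) i
  have hhlim : ∀ s ∈ Ioc (0:ℝ) 1,
      Tendsto (fun i => hh a q (F i) s) atTop (nhds (hh a q f s)) := by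
    intro s hs
    unfold hh
    refine Tendsto.const_mul _ (Tendsto.rpow_const ?_ (Or.inr hq))
    exact (hlim s hs).const_sub 1
  have hgood : GoodF a q f := by
    refine ⟨hmono, hnp, ?_⟩
    refine integrable_of_tendsto (G := fun i => hh a q (F i)) ?_
      (fun i => (hF i).int.1) ?_
    · exact (ae_restrict_iff' measurableSet_Ioc).2 (Eventually.of_forall hhlim)
    · have hle : ∀ i, ∫⁻ x in Ioc (0:ℝ) 1, ‖hh a q (F i) x‖ₑ ≤ ENNReal.ofReal M := by
        intro i
        rw [← ofReal_integral_norm_eq_lintegral_enorm (hF i).int]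
        apply ENNReal.ofReal_le_ofReal
        refine le_trans (le_of_eq ?_) (hM i)
        unfold II
        apply setIntegral_congr_fun measurableSet_Ioc
        intro s hs
        exact Real.norm_of_nonneg (hh_nonneg (hF i).nonpos hs)
      refine ne_top_of_le_ne_top (b := ENNReal.ofReal M) ENNReal.ofReal_ne_top ?_
      refine (liminf_le_liminf (Eventually.of_forall hle)).trans ?_
      simp
  have hJlim : ∀ τ ∈ Ioc (0:ℝ) 1, Tendsto (fun i => JJ a b C κ q (lam i) (F i) τ) atTop
      (nhds (JJ a b C κ q L f τ)) := by
    intro τ hτ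
    have hI : Tendsto (fun i => II a q (F i) τ) atTop (nhds (II a q f τ)) := by
      refine tendsto_integral_of_dominated_convergence (hh a q f) ?_ ?_ ?_ ?_
      · exact fun i => ((hF i).int.mono_set (Ioc_subset_Ioc_right hτ.2)).1
      · exact hgood.int.mono_set (Ioc_subset_Ioc_right hτ.2)
      · intro i
        refine (ae_restrict_iff' measurableSet_Ioc).2 (Eventually.of_forall fun s hs => ?_)
        have hs' : s ∈ Ioc (0:ℝ) 1 := ⟨hs.1, hs.2.trans hτ.2⟩
        rw [Real.norm_of_nonneg (hh_nonneg (hF i).nonpos hs')]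
        exact hh_le hq hs.1 ((hF i).nonpos s hs') (hfle i s hs')
      · refine (ae_restrict_iff' measurableSet_Ioc).2 (Eventually.of_forall fun s hs => ?_)
        exact hhlim s ⟨hs.1, hs.2.trans hτ.2⟩
    unfold JJ
    exact (Tendsto.const_mul _ (hlamlim.mul hI)).rpow_const (Or.inr hκ)
  refine ⟨hgood, fun r hr => ?_⟩
  have hL : 0 ≤ L := (hl 0).trans (hlL 0)
  unfold TT
  refine Tendsto.neg ?_
  refine tendsto_integral_of_dominated_convergence (JJ a b C κ q L f) ?_ ?_ ?_ ?_
  · exact fun i => JJ_meas (hF i)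
  · exact JJ_int hC hκ hb hL hgood hr.1
  · intro i
    refine (ae_restrict_iff' measurableSet_Ioc).2 (Eventually.of_forall fun s hs => ?_)
    have hs' : s ∈ Ioc (0:ℝ) 1 := ⟨hr.1.trans hs.1, hs.2⟩
    rw [Real.norm_of_nonneg (JJ_nonneg hC (hl i) (hF i).nonpos hs')]
    exact JJ_le hC hκ hq (hl i) (hlL i) (hF i) hgood (hfle i) hs'
  · refine (ae_restrict_iff' measurableSet_Ioc).2 (Eventually.of_forall fun s hs => ?_)
    exact hJlim s ⟨hr.1.trans hs.1, hs.2⟩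

lemma cnk_pos {n k : ℕ} (hk : 1 ≤ k) (hn : 2 * k < n) : 0 < cnk n k := by
  unfold cnk
  have h1 : 0 < n.choose k := Nat.choose_pos (by omega)
  have h2 : 0 < n := by omega
  positivity

lemma sol_facts {n k : ℕ} (hk : 1 ≤ k) (hn : 2 * k < n) {q σ lam : ℝ} (hq : (k : ℝ) < q)
    (hσ : 0 ≤ σ) {u : ℝ → ℝ} (h : IsRadialSol n k q σ lam u) :
    ∃ W : ℝ → ℝ, ContinuousOn W (Icc 0 1) ∧ (∀ r ∈ Ioo (0:ℝ) 1, HasDerivAt u (W r) r) ∧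
      ContinuousOn u (Icc 0 1) ∧
      GoodF ((n : ℝ) - 1 + σ) q u ∧
      (∀ r ∈ Ioc (0:ℝ) 1,
        W r = JJ ((n : ℝ) - 1 + σ) ((k : ℝ) - n) (cnk n k) (1 / (k : ℝ)) q lam u r) ∧
      (∀ r ∈ Ioc (0:ℝ) 1,
        u r = TT ((n : ℝ) - 1 + σ) ((k : ℝ) - n) (cnk n k) (1 / (k : ℝ)) q lam u r) := by
  obtain ⟨hC2, hC1, -, hu1, hneg, hmon, heq⟩ := h
  have hC := cnk_pos hk hn
  have hnk : (0:ℝ) < (n:ℝ) - k := by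
    have : ((2 * k : ℕ) : ℝ) < n := by exact_mod_cast hn
    push_cast at this
    have : (0:ℝ) ≤ k := by positivity
    linarith
  have hk1 : (1:ℝ) ≤ k := by exact_mod_cast hk
  have hn1 : (0:ℝ) < (n:ℝ) - 1 := by linarith
  have hq0 : 0 ≤ q := by linarith
  have hdw : ∀ r ∈ Ioo (0:ℝ) 1, derivWithin u (Icc 0 1) r = deriv u r := fun r hr =>
    derivWithin_of_mem_nhds (Icc_mem_nhds hr.1 hr.2)
  have hWc : ContinuousOn (derivWithin u (Icc 0 1)) (Icc 0 1) :=
    hC1.continuousOn_derivWithin (uniqueDiffOn_Icc zero_lt_one) le_rfl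
  have huc : ContinuousOn u (Icc 0 1) := hC1.continuousOn
  have hWd : ∀ r ∈ Ioo (0:ℝ) 1, HasDerivAt u (derivWithin u (Icc 0 1) r) r := by
    intro r hr
    rw [hdw r hr]
    exact ((hC2.differentiableOn (by norm_num)).differentiableAt
      (Ioo_mem_nhds hr.1 hr.2)).hasDerivAt
  have hd2 : ∀ r ∈ Ioo (0:ℝ) 1, DifferentiableAt ℝ (deriv u) r := by
    intro r hr
    have h1 : ContDiffOn ℝ 1 (deriv u) (Ioo 0 1) :=
      hC2.deriv_of_isOpen isOpen_Ioo (by norm_num)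
    exact (h1.differentiableOn (by norm_num)).differentiableAt (Ioo_mem_nhds hr.1 hr.2)
  set W := derivWithin u (Icc 0 1) with hW
  have hphi : ∀ i : ℕ, ∀ r ∈ Ioo (0:ℝ) 1,
      HasDerivAt (fun s => s ^ ((n : ℝ) - i) * (W s) ^ i)
        (deriv (fun s => s ^ ((n : ℝ) - i) * (deriv u s) ^ i) r) r := by
    intro i r hr
    have h1 : DifferentiableAt ℝ (fun s => s ^ ((n : ℝ) - i) * (deriv u s) ^ i) r :=
      (Real.differentiableAt_rpow_const_of_ne _ hr.1.ne').mul ((hd2 r hr).pow i)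
    refine h1.hasDerivAt.congr_of_eventuallyEq ?_
    filter_upwards [Ioo_mem_nhds hr.1 hr.2] with s hs
    rw [hdw s hs]
  have hW0 : ∀ r ∈ Ioc (0:ℝ) 1, 0 ≤ W r := by
    have hm : MonotoneOn (fun s => s ^ ((n : ℝ) - (1:ℕ)) * (W s) ^ 1) (Icc 0 1) := by
      apply monotoneOn_of_deriv_nonneg (convex_Icc 0 1)
      · apply ContinuousOn.mul
        · exact continuousOn_id.rpow_const fun x _ => Or.inr (by push_cast; exact hn1.le)
        · exact hWc.pow 1
      · rw [interior_Icc]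
        exact fun r hr => (hphi 1 r hr).differentiableAt.differentiableWithinAt
      · rw [interior_Icc]
        intro r hr
        rw [(hphi 1 r hr).deriv]
        exact hmon 1 le_rfl hk r hr
    intro r hr
    have := hm (left_mem_Icc.2 zero_le_one) ⟨hr.1.le, hr.2⟩ hr.1.le
    simp only [pow_one] at this
    rw [Real.zero_rpow (by push_cast; exact hn1.ne'), zero_mul] at this
    have h2 : (0:ℝ) < r ^ ((n : ℝ) - (1:ℕ)) := Real.rpow_pos_of_pos hr.1 _
    exact nonneg_of_mul_nonneg_right this h2
  have humono : MonotoneOn u (Icc 0 1) := by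
    apply monotoneOn_of_deriv_nonneg (convex_Icc 0 1) huc
    · rw [interior_Icc]
      exact fun r hr => (hWd r hr).differentiableAt.differentiableWithinAt
    · rw [interior_Icc]
      intro r hr
      rw [(hWd r hr).deriv]
      exact hW0 r ⟨hr.1, hr.2.le⟩
  have hunp : ∀ r ∈ Icc (0:ℝ) 1, u r ≤ 0 := by
    intro r hr
    rw [← hu1]
    exact humono hr (right_mem_Icc.2 zero_le_one) hr.2
  have hhc : ContinuousOn (hh ((n : ℝ) - 1 + σ) q u) (Icc 0 1) := by
    apply ContinuousOn.mul
    · exact continuousOn_id.rpow_const fun x _ => Or.inr (by linarith)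
    · exact (continuousOn_const.sub huc).rpow_const fun x _ => Or.inr hq0
  have hgood : GoodF ((n : ℝ) - 1 + σ) q u :=
    ⟨humono.mono Ioc_subset_Icc_self, fun r hr => hunp r (Ioc_subset_Icc_self hr),
      (hhc.integrableOn_Icc).mono_set Ioc_subset_Icc_self⟩
  have hWJ : ∀ r ∈ Ioc (0:ℝ) 1,
      W r = JJ ((n : ℝ) - 1 + σ) ((k : ℝ) - n) (cnk n k) (1 / (k : ℝ)) q lam u r := by
    intro r hr
    have hsub : Icc 0 r ⊆ Icc (0:ℝ) 1 := Icc_subset_Icc_right hr.2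
    have hF := intervalIntegral.integral_eq_sub_of_hasDerivAt_of_le
      (f := fun s => s ^ ((n : ℝ) - k) * (W s) ^ k)
      (f' := fun s => ((cnk n k)⁻¹ * lam) * hh ((n : ℝ) - 1 + σ) q u s) hr.1.le ?_ ?_ ?_
    · rw [intervalIntegral.integral_of_le hr.1.le, integral_const_mul,
        Real.zero_rpow hnk.ne', zero_mul, sub_zero] at hF
      unfold JJ
      have h1 : r ^ ((k : ℝ) - n) * r ^ ((n : ℝ) - k) = 1 := by
        rw [← Real.rpow_add hr.1]; simp
      have h2 : (cnk n k)⁻¹ * r ^ ((k : ℝ) - n) * (lam * II ((n : ℝ) - 1 + σ) q u r)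
          = W r ^ k := by
        have : (cnk n k)⁻¹ * r ^ ((k : ℝ) - n) * (lam * II ((n : ℝ) - 1 + σ) q u r)
          = r ^ ((k : ℝ) - n) * ((cnk n k)⁻¹ * lam * II ((n : ℝ) - 1 + σ) q u r) := by ring
        rw [this]
        unfold II
        rw [hF, ← mul_assoc, h1, one_mul]
      rw [h2, one_div, Real.pow_rpow_inv_natCast (hW0 r hr) (by omega)]
    · apply ContinuousOn.mul
      · exact continuousOn_id.rpow_const fun x _ => Or.inr hnk.le
      · exact (hWc.mono hsub).pow k
    · intro s hs
      have hs' : s ∈ Ioo (0:ℝ) 1 := ⟨hs.1, hs.2.trans_le hr.2⟩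
      refine (hphi k s hs').congr_deriv (Eq.symm ?_)
      have he := heq s hs'
      have hs0 := hs.1
      have h1 : s ^ ((n : ℝ) - 1) * s ^ (1 - (n : ℝ)) = 1 := by
        rw [← Real.rpow_add hs.1]; simp
      unfold hh
      rw [Real.rpow_add hs.1]
      set D := deriv (fun s => s ^ ((n : ℝ) - k) * (deriv u s) ^ k) s
      calc (cnk n k)⁻¹ * lam * (s ^ ((n:ℝ) - 1) * s ^ σ * (1 - u s) ^ q)
          = (cnk n k)⁻¹ * s ^ ((n:ℝ) - 1) * (lam * s ^ σ * (1 - u s) ^ q) := by ring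
        _ = ((cnk n k)⁻¹ * cnk n k) * (s ^ ((n : ℝ) - 1) * s ^ (1 - (n : ℝ))) * D := by
          rw [← he]; ring
        _ = D := by rw [h1, inv_mul_cancel₀ hC.ne']; ring
    · apply ContinuousOn.intervalIntegrable
      rw [uIcc_of_le hr.1.le]
      exact (continuousOn_const.mul hhc).mono hsub
  refine ⟨W, hWc, hWd, huc, hgood, hWJ, ?_⟩
  intro r hr
  have hsub : Icc r 1 ⊆ Icc (0:ℝ) 1 := Icc_subset_Icc_left hr.1.le
  have hF := intervalIntegral.integral_eq_sub_of_hasDerivAt_of_le (f := u) (f' := W) hr.2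
    (huc.mono hsub) (fun x hx => hWd x ⟨hr.1.trans hx.1, hx.2⟩) (by
      apply ContinuousOn.intervalIntegrable
      rw [uIcc_of_le hr.2]
      exact hWc.mono hsub)
  rw [intervalIntegral.integral_of_le hr.2, hu1] at hF
  unfold TT
  rw [← setIntegral_congr_fun measurableSet_Ioc
    (fun x hx => hWJ x ⟨hr.1.trans hx.1, hx.2⟩), hF]
  ring

lemma sol_bound {n k : ℕ} (hk : 1 ≤ k) (hn : 2 * k < n) {q σ lam0 : ℝ} (hq : (k : ℝ) < q)
    (hσ : 0 ≤ σ) (hl0 : 0 < lam0) {r : ℝ} (hr : r ∈ Ioo (0:ℝ) 1) :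
    ∃ K : ℝ, 0 ≤ K ∧ ∀ lam u, lam0 ≤ lam → IsRadialSol n k q σ lam u → -K ≤ u r := by
  have hC := cnk_pos hk hn
  have hk1 : (1:ℝ) ≤ k := by exact_mod_cast hk
  have hk0 : (0:ℝ) < k := by linarith
  have hnk : (k:ℝ) - n ≤ 0 := by
    have : ((2 * k : ℕ) : ℝ) < n := by exact_mod_cast hn
    push_cast at this
    linarith
  have hq0 : 0 < q := by linarith
  have hr0 := hr.1
  set a := (n : ℝ) - 1 + σ with ha
  have ha0 : 0 ≤ a := by linarith
  set p := q * (1 / (k:ℝ)) with hp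
  have hp1 : 1 < p := by
    rw [hp, mul_one_div, lt_div_iff₀ hk0]; linarith
  set E := ((cnk n k)⁻¹ * (lam0 * ((r / 4) ^ a * (r / 4)))) ^ (1 / (k:ℝ)) with hE
  have hE0 : 0 < E := by positivity
  set D := (p - 1) * E * (r / 2) with hD
  have hD0 : 0 < D := by
    have : 0 < p - 1 := by linarith
    positivity
  refine ⟨D ^ (1 / (1 - p)), by positivity, ?_⟩
  intro lam u hlam hu
  obtain ⟨W, hWc, hWd, huc, hgood, hWJ, -⟩ := sol_facts hk hn hq hσ hu
  have hxpos : ∀ t ∈ Ioc (0:ℝ) 1, 0 < 1 - u t := fun t ht => by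
    have := hgood.nonpos t ht
    linarith
  have hWlow : ∀ t ∈ Ioo (r / 2) r, E * (1 - u t) ^ p ≤ W t := by
    intro t ht
    have ht0 : 0 < t := by linarith [ht.1]
    have ht1 : t ∈ Ioc (0:ℝ) 1 := ⟨ht0, by linarith [ht.2, hr.2]⟩
    have hx := hxpos t ht1
    have hII : (r / 4) ^ a * (r / 4) * (1 - u t) ^ q ≤ II a q u t := by
      have hint : IntegrableOn (hh a q u) (Ioc 0 t) :=
        hgood.int.mono_set (Ioc_subset_Ioc_right ht1.2)
      have h1 : ∫ s in Ioc (t / 2) t, (r / 4) ^ a * (1 - u t) ^ q ≤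
          ∫ s in Ioc (t / 2) t, hh a q u s := by
        apply setIntegral_mono_on (integrable_const _)
          (hint.mono_set (Ioc_subset_Ioc_left (by linarith))) measurableSet_Ioc
        intro s hs
        have hs0 : r / 4 ≤ s := by linarith [hs.1, ht.1]
        have hs1 : s ∈ Ioc (0:ℝ) 1 := ⟨by linarith, hs.2.trans ht1.2⟩
        have := hgood.mono hs1 ht1 hs.2
        have hs2 : 0 < s := hs1.1
        unfold hh
        gcongr
      have h2 : ∫ s in Ioc (t / 2) t, hh a q u s ≤ II a q u t := by
        apply setIntegral_mono_set hint
        · exact (ae_restrict_iff' measurableSet_Ioc).2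
            (Eventually.of_forall fun s hs => hh_nonneg hgood.nonpos ⟨hs.1, hs.2.trans ht1.2⟩)
        · exact (Ioc_subset_Ioc_left (by linarith)).eventuallyLE
      refine le_trans ?_ (h1.trans h2)
      rw [setIntegral_const, Real.volume_real_Ioc_of_le (by linarith), smul_eq_mul]
      have : r / 4 ≤ t - t / 2 := by linarith [ht.1]
      have h3 : 0 ≤ (r / 4) ^ a * (1 - u t) ^ q := by positivity
      nlinarith [mul_le_mul_of_nonneg_right this h3]
    rw [hWJ t ht1, hE, hp, Real.rpow_mul hx.le, ← Real.mul_rpow (by positivity) (by positivity)]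
    unfold JJ
    apply Real.rpow_le_rpow (by positivity) _ (by positivity)
    have htb : 1 ≤ t ^ ((k:ℝ) - n) := Real.one_le_rpow_of_pos_of_le_one_of_nonpos ht0 ht1.2 hnk
    have hI0 : 0 ≤ (r / 4) ^ a * (r / 4) * (1 - u t) ^ q := by positivity
    have hlam0 : 0 ≤ lam := hl0.le.trans hlam
    calc (cnk n k)⁻¹ * (lam0 * ((r / 4) ^ a * (r / 4))) * (1 - u t) ^ q
        = (cnk n k)⁻¹ * 1 * (lam0 * ((r / 4) ^ a * (r / 4) * (1 - u t) ^ q)) := by ring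
      _ ≤ (cnk n k)⁻¹ * t ^ ((k:ℝ) - n) * (lam * II a q u t) := by gcongr
  obtain ⟨t, ht, hslope⟩ := exists_hasDerivAt_eq_slope (fun t => (1 - u t) ^ (1 - p))
    (fun t => (-(W t)) * (1 - p) * (1 - u t) ^ (1 - p - 1)) (a := r / 2) (b := r)
    (by linarith) (by
      have hs : Icc (r / 2) r ⊆ Icc 0 1 := Icc_subset_Icc (by linarith) hr.2.le
      apply (continuousOn_const.sub (huc.mono hs)).rpow_const
      intro x hx
      left
      exact (hxpos x ⟨by linarith [hx.1], by linarith [hx.2, hr.2]⟩).ne') (by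
      intro x hx
      have hx1 : x ∈ Ioo (0:ℝ) 1 := ⟨by linarith [hx.1], by linarith [hx.2, hr.2]⟩
      exact ((hWd x hx1).const_sub 1).rpow_const (Or.inl (hxpos x ⟨hx1.1, hx1.2.le⟩).ne'))
  have ht1 : t ∈ Ioc (0:ℝ) 1 := ⟨by linarith [ht.1], by linarith [ht.2, hr.2]⟩
  have hx := hxpos t ht1
  have hxr := hxpos r ⟨hr.1, hr.2.le⟩
  have hg : D ≤ (1 - u r) ^ (1 - p) := by
    have h1 : (p - 1) * E ≤ (-(W t)) * (1 - p) * (1 - u t) ^ (1 - p - 1) := by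
      have h2 := hWlow t ht
      have h3 : (1 - u t) ^ p * (1 - u t) ^ (1 - p - 1) = 1 := by
        rw [← Real.rpow_add hx]; simp
      have h4 : 0 < (1 - u t) ^ (1 - p - 1) := by positivity
      calc (p - 1) * E = (p - 1) * (E * (1 - u t) ^ p * (1 - u t) ^ (1 - p - 1)) := by
            rw [mul_assoc E, h3, mul_one]
        _ ≤ (p - 1) * (W t * (1 - u t) ^ (1 - p - 1)) := by
            apply mul_le_mul_of_nonneg_left _ (by linarith)
            exact mul_le_mul_of_nonneg_right h2 h4.le
        _ = _ := by ring
    rw [hslope, le_div_iff₀ (by linarith)] at h1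
    have h5 : 0 ≤ (1 - u (r / 2)) ^ (1 - p) :=
      Real.rpow_nonneg (hxpos _ ⟨by linarith, by linarith [hr.2]⟩).le _
    have h6 : (p - 1) * E * (r - r / 2) = D := by rw [hD]; ring
    linarith
  have h7 := Real.rpow_le_rpow_of_nonpos hD0 hg (z := 1 / (1 - p))
    (one_div_nonpos.2 (by linarith))
  rw [← Real.rpow_mul hxr.le, mul_one_div_cancel (by linarith), Real.rpow_one] at h7
  linarith

lemma sol_II_bound {n k : ℕ} (hk : 1 ≤ k) (hn : 2 * k < n) {q σ lam0 : ℝ} (hq : (k : ℝ) < q)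
    (hσ : 0 ≤ σ) (hl0 : 0 < lam0) :
    ∃ M : ℝ, ∀ lam u, lam0 ≤ lam → IsRadialSol n k q σ lam u →
      II ((n : ℝ) - 1 + σ) q u 1 ≤ M := by
  have hC := cnk_pos hk hn
  have hk1 : (1:ℝ) ≤ k := by exact_mod_cast hk
  have hk0 : (0:ℝ) < k := by linarith
  have hnk : (k:ℝ) - n ≤ 0 := by
    have : ((2 * k : ℕ) : ℝ) < n := by exact_mod_cast hn
    push_cast at this
    linarith
  have hq0 : 0 < q := by linarith
  obtain ⟨K, hK0, hK⟩ := sol_bound hk hn hq hσ hl0 (r := 1 / 2) (by norm_num)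
  refine ⟨cnk n k / lam0 * (2 * K) ^ k + 1 * (1 + K) ^ q, ?_⟩
  intro lam u hlam hu
  have hKu := hK lam u hlam hu
  obtain ⟨W, hWc, hWd, huc, hgood, hWJ, hT⟩ := sol_facts hk hn hq hσ hu
  set a := (n : ℝ) - 1 + σ with ha
  have ha0 : 0 ≤ a := by linarith
  have hsplit : II a q u 1 = II a q u (1 / 2) + ∫ s in Ioc (1 / 2 : ℝ) 1, hh a q u s := by
    unfold II
    rw [← setIntegral_union _ measurableSet_Ioc, Ioc_union_Ioc_eq_Ioc (by norm_num) (by norm_num)]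
    · exact hgood.int.mono_set (Ioc_subset_Ioc_right (by norm_num))
    · exact hgood.int.mono_set (Ioc_subset_Ioc_left (by norm_num))
    · exact Ioc_disjoint_Ioc_of_le le_rfl
  rw [hsplit]
  have hI0 := II_nonneg (a := a) (q := q) hgood.nonpos (τ := 1 / 2) (by norm_num)
  have hhalf : (1 / 2 : ℝ) ∈ Ioc (0:ℝ) 1 := by norm_num
  apply add_le_add
  · have h1 : ∫ τ in Ioc (1 / 2 : ℝ) 1, ((cnk n k)⁻¹ * (lam0 * II a q u (1 / 2))) ^ (1 / (k:ℝ)) ≤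
        ∫ τ in Ioc (1 / 2 : ℝ) 1, JJ a ((k : ℝ) - n) (cnk n k) (1 / (k : ℝ)) q lam u τ := by
      apply setIntegral_mono_on (integrable_const _)
        (JJ_int hC (by positivity) hnk (hl0.le.trans hlam) hgood (by norm_num)) measurableSet_Ioc
      intro t ht
      have ht0 : 0 < t := by linarith [ht.1]
      unfold JJ
      apply Real.rpow_le_rpow (by positivity) _ (by positivity)
      have htb : 1 ≤ t ^ ((k:ℝ) - n) := Real.one_le_rpow_of_pos_of_le_one_of_nonpos ht0 ht.2 hnk
      have hm := II_mono hgood ht.1.le ht.2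
      have hlam0 : 0 ≤ lam := hl0.le.trans hlam
      calc (cnk n k)⁻¹ * (lam0 * II a q u (1 / 2))
          = (cnk n k)⁻¹ * 1 * (lam0 * II a q u (1 / 2)) := by ring
        _ ≤ (cnk n k)⁻¹ * t ^ ((k:ℝ) - n) * (lam * II a q u t) := by gcongr
    rw [setIntegral_const, Real.volume_real_Ioc_of_le (by norm_num), smul_eq_mul] at h1
    have h2 := hT _ hhalf
    unfold TT at h2
    have h3 : ((cnk n k)⁻¹ * (lam0 * II a q u (1 / 2))) ^ (1 / (k:ℝ)) ≤ 2 * K := by linarith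
    have h4 := pow_le_pow_left₀ (by positivity) h3 k
    rw [one_div (k:ℝ), Real.rpow_inv_natCast_pow (by positivity) (by omega)] at h4
    calc II a q u (1 / 2)
        = cnk n k / lam0 * ((cnk n k)⁻¹ * (lam0 * II a q u (1 / 2))) := by
          field_simp
      _ ≤ _ := by gcongr
  · have h1 : ∫ s in Ioc (1 / 2 : ℝ) 1, hh a q u s ≤ ∫ s in Ioc (1 / 2 : ℝ) 1, (1 + K) ^ q := by
      apply setIntegral_mono_on (hgood.int.mono_set (Ioc_subset_Ioc_left (by norm_num)))
        (by simp) measurableSet_Ioc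
      intro s hs
      have hs1 : s ∈ Ioc (0:ℝ) 1 := ⟨by linarith [hs.1], hs.2⟩
      have hm := hgood.mono hhalf hs1 hs.1.le
      have hnp := hgood.nonpos s hs1
      unfold hh
      have h2 : s ^ a ≤ 1 := Real.rpow_le_one hs1.1.le hs1.2 ha0
      have h3 : (1 - u s) ^ q ≤ (1 + K) ^ q :=
        Real.rpow_le_rpow (by linarith) (by linarith) hq0.le
      have h4 : 0 ≤ (1 - u s) ^ q := Real.rpow_nonneg (by linarith) _
      nlinarith
    refine h1.trans ?_
    rw [setIntegral_const, Real.volume_real_Ioc_of_le (by norm_num), smul_eq_mul]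
    have : 0 ≤ (1 + K) ^ q := by positivity
    nlinarith

lemma sol_subsol {n k : ℕ} {q σ lam mu : ℝ} (h : lam ≤ mu) {u : ℝ → ℝ}
    (hu : IsRadialSol n k q σ mu u) : IsRadialSubsol n k q σ lam u := by
  obtain ⟨h1, h2, -, h4, h5, h6, h7⟩ := hu
  refine ⟨h1, h2, h6, ?_, h4.le⟩
  intro r hr
  rw [h7 r hr]
  have := h5 r hr
  have h8 : 0 ≤ (1 - u r) ^ q := Real.rpow_nonneg (by linarith) _
  have h9 : 0 ≤ r ^ σ := Real.rpow_nonneg hr.1.le _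
  gcongr

/-- The diagonal iteration. -/
def diagIter (T : ℕ → (ℝ → ℝ) → ℝ → ℝ) : ℕ → ℝ → ℝ
  | 0 => fun _ => 0
  | (i + 1) => T i (diagIter T i)

/-- existence of a limit from any family squeezed by classical solutions -/
lemma fixed_point_of_seq {n k : ℕ} (hk : 1 ≤ k) (hn : 2 * k < n) {q σ : ℝ} (hq : (k : ℝ) < q)
    (hσ : 0 ≤ σ) (lam : ℕ → ℝ) (hpos : ∀ i, 0 < lam i) (hmono : Monotone lam) (L : ℝ)
    (hlim : Tendsto lam atTop (nhds L)) (v : ℕ → ℝ → ℝ)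
    (hv : ∀ i, IsRadialSol n k q σ (lam i) (v i)) (F G : ℕ → ℝ → ℝ)
    (hF : ∀ i, GoodF ((n : ℝ) - 1 + σ) q (F i))
    (hanti : ∀ r ∈ Ioc (0:ℝ) 1, Antitone fun i => F i r)
    (hFv : ∀ i, ∀ r ∈ Ioc (0:ℝ) 1, v i r ≤ F i r)
    (hG : ∀ i, ∀ r ∈ Ioc (0:ℝ) 1, G i r =
      TT ((n : ℝ) - 1 + σ) ((k : ℝ) - n) (cnk n k) (1 / (k : ℝ)) q (lam i) (F i) r)
    (hFG : ∀ f : ℝ, ∀ r ∈ Ioc (0:ℝ) 1, Tendsto (fun i => F i r) atTop (nhds f) →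
      Tendsto (fun i => G i r) atTop (nhds f)) :
    ∃ f : ℝ → ℝ, (∀ r ∈ Ioc (0:ℝ) 1, f r ≤ 0) ∧
      (∀ r ∈ Ioc (0:ℝ) 1, Tendsto (fun i => F i r) atTop (nhds (f r))) ∧
      (∀ r ∈ Ioc (0:ℝ) 1, f r =
        TT ((n : ℝ) - 1 + σ) ((k : ℝ) - n) (cnk n k) (1 / (k : ℝ)) q L f r) := by
  have hC := cnk_pos hk hn
  have hk1 : (1:ℝ) ≤ k := by exact_mod_cast hk
  have hnk : (k:ℝ) - n ≤ 0 := by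
    have : ((2 * k : ℕ) : ℝ) < n := by exact_mod_cast hn
    push_cast at this
    linarith
  have hq0 : 0 ≤ q := by linarith
  have hb : ∀ r ∈ Ioc (0:ℝ) 1, ∃ K : ℝ, ∀ i, -K ≤ F i r := by
    intro r hr
    rcases hr.2.lt_or_eq with h | h
    · obtain ⟨K, -, hK⟩ := sol_bound hk hn hq hσ (hpos 0) (r := r) ⟨hr.1, h⟩
      exact ⟨K, fun i => (hK (lam i) (v i) (hmono (Nat.zero_le i)) (hv i)).trans (hFv i r hr)⟩
    · refine ⟨0, fun i => ?_⟩
      have h1 := (hv i).2.2.2.1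
      have h2 := hFv i r hr
      rw [h] at h2 ⊢
      linarith
  have hex : ∀ r : ℝ, ∃ y : ℝ, r ∈ Ioc (0:ℝ) 1 → Tendsto (fun i => F i r) atTop (nhds y) := by
    intro r
    by_cases hr : r ∈ Ioc (0:ℝ) 1
    · obtain ⟨K, hK⟩ := hb r hr
      refine ⟨⨅ i, F i r, fun _ => tendsto_atTop_ciInf (hanti r hr) ⟨-K, ?_⟩⟩
      rintro _ ⟨i, rfl⟩
      exact hK i
    · exact ⟨0, fun h => absurd h hr⟩
  choose f hf using hex
  obtain ⟨M, hM⟩ := sol_II_bound hk hn hq hσ (hpos 0)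
  have hgv : ∀ i, GoodF ((n : ℝ) - 1 + σ) q (v i) := fun i => by
    obtain ⟨W, -, -, -, hg, -⟩ := sol_facts hk hn hq hσ (hv i)
    exact hg
  obtain ⟨hg, ht⟩ := limit_lemma (b := (k : ℝ) - n) (κ := 1 / (k:ℝ)) hC (by positivity) hnk hq0 F hF
    hanti f (fun r hr => hf r hr) M
    (fun i => (II_anti hq0 (hF i) (hgv i) (hFv i) le_rfl).trans
      (hM (lam i) (v i) (hmono (Nat.zero_le i)) (hv i)))
    lam L (fun i => (hpos i).le) (fun i => hmono.ge_of_tendsto hlim i) hlim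
  refine ⟨f, hg.nonpos, fun r hr => hf r hr, fun r hr => ?_⟩
  have h1 := hFG _ r hr (hf r hr)
  refine tendsto_nhds_unique h1 ((ht r hr).congr fun i => (hG i r hr).symm)

lemma to_statement {n k : ℕ} {q σ L : ℝ} {f : ℝ → ℝ}
    (hf : ∀ r ∈ Ioc (0:ℝ) 1, f r =
        TT ((n : ℝ) - 1 + σ) ((k : ℝ) - n) (cnk n k) (1 / (k : ℝ)) q L f r) :
    ∀ᵐ r ∂(volume.restrict (Ioo (0:ℝ) 1)),
        f r = -∫ τ in r..(1:ℝ),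
          ((cnk n k)⁻¹ * τ ^ ((k : ℝ) - n) *
            ∫ s in (0:ℝ)..τ, s ^ ((n : ℝ) - 1 + σ) * L * (1 - f s) ^ q) ^ (1 / (k : ℝ)) := by
  refine (ae_restrict_iff' measurableSet_Ioo).2 (Eventually.of_forall fun r hr => ?_)
  rw [hf r ⟨hr.1, hr.2.le⟩, intervalIntegral.integral_of_le hr.2.le]
  unfold TT
  congr 1
  apply setIntegral_congr_fun measurableSet_Ioc
  intro τ hτ
  have h0 : 0 ≤ τ := (hr.1.trans hτ.1).le
  simp only [JJ, II, hh]
  rw [intervalIntegral.integral_of_le h0, ← integral_const_mul]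
  congr 3
  ext s
  ring

/-- A sequence of maximal solutions with parameters increasing to `L`. -/
def MaxSeq (n k : ℕ) (q σ L : ℝ) (lamSeq : ℕ → ℝ) (useq : ℕ → ℝ → ℝ) : Prop :=
  (∀ i, 0 < lamSeq i) ∧ StrictMono lamSeq ∧ Tendsto lamSeq atTop (nhds L) ∧
    (∀ i, IsRadialSol n k q σ (lamSeq i) (useq i) ∧
            ∀ v : ℝ → ℝ, IsRadialSubsol n k q σ (lamSeq i) v →
              ∀ r ∈ Icc (0:ℝ) 1, v r ≤ useq i r)

lemma MaxSeq.anti {n k : ℕ} {q σ L : ℝ} {lamSeq : ℕ → ℝ} {useq : ℕ → ℝ → ℝ}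
    (h : MaxSeq n k q σ L lamSeq useq) :
    ∀ r ∈ Icc (0:ℝ) 1, Antitone fun i => useq i r := fun r hr i j hij =>
  (h.2.2.2 i).2 _ (sol_subsol (h.2.1.monotone hij) (h.2.2.2 j).1) r hr

lemma MaxSeq.cross {n k : ℕ} {q σ L : ℝ} {lamSeq mu : ℕ → ℝ} {useq y : ℕ → ℝ → ℝ}
    (h : MaxSeq n k q σ L lamSeq useq) (h' : MaxSeq n k q σ L mu y) (i : ℕ) :
    ∀ᶠ j in atTop, ∀ r ∈ Icc (0:ℝ) 1, y j r ≤ useq i r := by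
  have hlt : lamSeq i < L :=
    (h.2.1 (Nat.lt_succ_self i)).trans_le (h.2.1.monotone.ge_of_tendsto h.2.2.1 _)
  filter_upwards [(tendsto_order.1 h'.2.2.1).1 _ hlt] with j hj r hr
  exact (h.2.2.2 i).2 _ (sol_subsol hj.le (h'.2.2.2 j).1) r hr

lemma main_aux (n k : ℕ) (hk : 1 ≤ k) (hn : 2 * k < n)
    (q σ : ℝ) (hq : (k : ℝ) < q) (hσ : 0 ≤ σ) (S : Set ℝ)
    (hS : S = {lam : ℝ | 0 < lam ∧ ∃ u : ℝ → ℝ, IsRadialSol n k q σ lam u}) :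
    ∃ f : ℝ → ℝ, (∀ r ∈ Ioc (0:ℝ) 1, f r ≤ 0) ∧
      (∀ r ∈ Ioc (0:ℝ) 1, f r =
        TT ((n : ℝ) - 1 + σ) ((k : ℝ) - n) (cnk n k) (1 / (k : ℝ)) q (sSup S) f r) ∧
      ∀ lamSeq useq, MaxSeq n k q σ (sSup S) lamSeq useq →
        ∀ r ∈ Ioc (0:ℝ) 1, Tendsto (fun i => useq i r) atTop (nhds (f r)) := by
  have hC := cnk_pos hk hn
  have hk1 : (1:ℝ) ≤ k := by exact_mod_cast hk
  have hnk : (k:ℝ) - n ≤ 0 := by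
    have : ((2 * k : ℕ) : ℝ) < n := by exact_mod_cast hn
    push_cast at this
    linarith
  have hq0 : 0 ≤ q := by linarith
  have hκ : 0 ≤ 1 / (k:ℝ) := by positivity
  by_cases hA : ∃ lamSeq useq, MaxSeq n k q σ (sSup S) lamSeq useq
  · obtain ⟨lam, u, h⟩ := hA
    have hfacts := fun i => sol_facts hk hn hq hσ (h.2.2.2 i).1
    have hgood : ∀ i, GoodF ((n : ℝ) - 1 + σ) q (u i) := fun i => by
      obtain ⟨W, -, -, -, hg, -⟩ := hfacts i
      exact hg
    have hT : ∀ i, ∀ r ∈ Ioc (0:ℝ) 1, u i r =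
      TT ((n : ℝ) - 1 + σ) ((k : ℝ) - n) (cnk n k) (1 / (k : ℝ)) q (lam i) (u i) r := fun i => by
      obtain ⟨W, -, -, -, -, -, hg⟩ := hfacts i
      exact hg
    obtain ⟨f, hf1, hf2, hf3⟩ := fixed_point_of_seq hk hn hq hσ lam h.1 h.2.1.monotone _ h.2.2.1 u
      (fun i => (h.2.2.2 i).1) u u hgood (fun r hr => h.anti r (Ioc_subset_Icc_self hr))
      (fun i r hr => le_rfl) hT (fun _ _ _ h => h)
    refine ⟨f, hf1, hf3, ?_⟩
    intro mu y h' r hr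
    have hr' := Ioc_subset_Icc_self hr
    rw [tendsto_order]
    constructor
    · intro c hc
      refine Eventually.of_forall fun j => hc.trans_le ?_
      refine le_of_tendsto (hf2 r hr) ?_
      filter_upwards [h'.cross h j] with i hi
      exact hi r hr'
    · intro c hc
      obtain ⟨i, hi⟩ := ((tendsto_order.1 (hf2 r hr)).2 c hc).exists
      filter_upwards [h.cross h' i] with j hj
      exact (hj r hr').trans_lt hi
  · push Not at hA
    by_cases hL : sSup S = 0
    · refine ⟨fun _ => 0, fun _ _ => le_rfl, ?_, fun l u h => absurd h (hA l u)⟩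
      intro r hr
      rw [hL]
      have : (1 / (k:ℝ)) ≠ 0 := by positivity
      simp only [TT, JJ, zero_mul, mul_zero, Real.zero_rpow this, integral_zero, neg_zero]
    · have hne : S.Nonempty := by
        by_contra hcon
        rw [not_nonempty_iff_eq_empty] at hcon
        exact hL (by rw [hcon, Real.sSup_empty])
      have hbdd : BddAbove S := by
        by_contra hcon
        exact hL (Real.sSup_of_not_bddAbove hcon)
      obtain ⟨lam, hmono, hlim, hmem⟩ := exists_seq_tendsto_sSup hne hbdd
      have hpos : ∀ i, 0 < lam i := fun i => by
        have := hmem i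
        rw [hS] at this
        exact this.1
      have hex : ∀ i, ∃ u : ℝ → ℝ, IsRadialSol n k q σ (lam i) u := fun i => by
        have := hmem i
        rw [hS] at this
        exact this.2
      choose v hv using hex
      have hfacts := fun i => sol_facts hk hn hq hσ (hv i)
      have hgood : ∀ i, GoodF ((n : ℝ) - 1 + σ) q (v i) := fun i => by
        obtain ⟨W, -, -, -, hg, -⟩ := hfacts i
        exact hg
      have hT : ∀ i, ∀ r ∈ Ioc (0:ℝ) 1, v i r =
        TT ((n : ℝ) - 1 + σ) ((k : ℝ) - n) (cnk n k) (1 / (k : ℝ)) q (lam i) (v i) r :=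
          fun i => by
        obtain ⟨W, -, -, -, -, -, hg⟩ := hfacts i
        exact hg
      set T : ℕ → (ℝ → ℝ) → ℝ → ℝ := fun i =>
        TT ((n : ℝ) - 1 + σ) ((k : ℝ) - n) (cnk n k) (1 / (k : ℝ)) q (lam i) with hTdef
      have key : ∀ i, GoodF ((n : ℝ) - 1 + σ) q (diagIter T i) ∧
          ∀ j, i ≤ j → ∀ r ∈ Ioc (0:ℝ) 1, v j r ≤ diagIter T i r := by
        intro i
        induction i with
        | zero =>
          have h0 : ∀ j, ∀ r ∈ Ioc (0:ℝ) 1, v j r ≤ diagIter T 0 r :=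
            fun j r hr => (hgood j).nonpos r hr
          exact ⟨GoodF_of_le hq0 (hgood 0) (fun _ _ _ _ _ => le_rfl) (fun _ _ => le_rfl) (h0 0),
            fun j _ => h0 j⟩
        | succ i ih =>
          obtain ⟨ih1, ih2⟩ := ih
          have h0 : ∀ j, i ≤ j → ∀ r ∈ Ioc (0:ℝ) 1, v j r ≤ diagIter T (i + 1) r := by
            intro j hj r hr
            rw [hT j r hr]
            exact TT_le hC hκ hnk hq0 (hpos i).le (hmono hj) ih1 (hgood j) (ih2 j hj) hr.1
          exact ⟨GoodF_of_le hq0 (hgood i) (TT_mono hC hκ hnk (hpos i).le ih1)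
            (fun r hr => TT_nonpos hC (hpos i).le ih1 hr.1) (h0 i le_rfl),
            fun j hj => h0 j (by omega)⟩
      have hstep : ∀ i, ∀ r ∈ Ioc (0:ℝ) 1, diagIter T (i + 1) r ≤ diagIter T i r := by
        intro i
        induction i with
        | zero => exact fun r hr => (key 1).1.nonpos r hr
        | succ i ih =>
          intro r hr
          exact TT_le hC hκ hnk hq0 (hpos i).le (hmono (Nat.le_succ i)) (key i).1 (key (i + 1)).1
            ih hr.1
      obtain ⟨f, hf1, hf2, hf3⟩ := fixed_point_of_seq hk hn hq hσ lam hpos hmono _ hlim v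
        hv (diagIter T) (fun i => diagIter T (i + 1)) (fun i => (key i).1)
        (fun r hr => antitone_nat_of_succ_le fun i => hstep i r hr)
        (fun i => (key i).2 i le_rfl) (fun _ _ _ => rfl)
        (fun f r hr h => h.comp (tendsto_add_atTop_nat 1))
      exact ⟨f, hf1, hf3, fun l u h => absurd h (hA l u)⟩

/-- at the extremal parameter `λ* = sup {λ > 0 : (P_λ) solvable}` there is an
integral solution `u* ≤ 0` on `(0,1]` satisfying the integral identity a.e., and `u*` is
the pointwise decreasing limit of the maximal solutions along any increasing
sequence `λ_i ↑ λ*`. -/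
theorem integral_solution_at_extremal_parameter (n k : ℕ) (hk : 1 ≤ k) (hn : 2 * k < n)
    (q σ : ℝ) (hq : (k : ℝ) < q) (hσ : 0 ≤ σ) :
    ∃ uStar : ℝ → ℝ,
      (∀ r ∈ Ioc (0:ℝ) 1, uStar r ≤ 0) ∧
      (∀ᵐ r ∂(volume.restrict (Ioo (0:ℝ) 1)),
        uStar r = -∫ τ in r..(1:ℝ),
          ((cnk n k)⁻¹ * τ ^ ((k : ℝ) - n) *
            ∫ s in (0:ℝ)..τ, s ^ ((n : ℝ) - 1 + σ) *
              sSup {lam : ℝ | 0 < lam ∧ ∃ u : ℝ → ℝ, IsRadialSol n k q σ lam u} *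
              (1 - uStar s) ^ q) ^ (1 / (k : ℝ))) ∧
      (∀ lamSeq : ℕ → ℝ, (∀ i, 0 < lamSeq i) → StrictMono lamSeq →
        Tendsto lamSeq atTop
          (nhds (sSup {lam : ℝ | 0 < lam ∧ ∃ u : ℝ → ℝ, IsRadialSol n k q σ lam u})) →
        ∀ useq : ℕ → ℝ → ℝ,
          (∀ i, IsRadialSol n k q σ (lamSeq i) (useq i) ∧
            ∀ v : ℝ → ℝ, IsRadialSubsol n k q σ (lamSeq i) v →
              ∀ r ∈ Icc (0:ℝ) 1, v r ≤ useq i r) →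
          (∀ r ∈ Icc (0:ℝ) 1, Antitone fun i => useq i r) ∧
          (∀ r ∈ Ioc (0:ℝ) 1, Tendsto (fun i => useq i r) atTop (nhds (uStar r)))) := by
  obtain ⟨f, hf1, hf2, hf3⟩ := main_aux n k hk hn q σ hq hσ _ rfl
  refine ⟨f, hf1, to_statement hf2, ?_⟩
  intro lamSeq h1 h2 h3 useq h4
  have h : MaxSeq n k q σ _ lamSeq useq := ⟨h1, h2, h3, h4⟩
  exact ⟨h.anti, hf3 _ _ h⟩
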